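/- Let A be a simply-laced GCM, V := ℝⁿ with b(x,y) := xᵀAy, ε the standard 2-cocycle of A, and Γ : ℤⁿ → End(S) a generalized Γ-matrix. For γ ∈ ℤⁿ ⊆ V with b(γ,γ) = 2 let s_γ(v) := v − b(γ,v)·γ and T_γ := (s_γ − ½·id_V) ⊗ Γ(γ) ∈ End(V ⊗ S). Fix i and set R_i := (1/√2)·s_{e_i} ⊗ (id + Γ(e_i)). Then R_i is invertible with inverse (1/√2)·s_{e_i} ⊗ (id − Γ(e_i)), and for every β ∈ ℤⁿ with b(β,β) = 2, writing s_i·β := β − b(e_i,β)·e_i: if b(e_i,β) is even then R_i ∘ T_β ∘ R_i^{−1} = T_{s_i·β}, and if b(e_i,β) is odd then R_i ∘ T_β ∘ R_i^{−1} = ε(e_i,β)·T_{s_i·β}. (This conjugation by the spin-extended Weyl group parametrizes the 3/2-spin representation matrices, up to sign, on all real root spaces.) -/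

import Mathlib

open scoped BigOperators TensorProduct

noncomputable section

/-- The pairing `(α|β) = αᵀ B β` on `ℤⁿ` induced by an integer matrix `B`. -/
def pairB {n : ℕ} (B : Matrix (Fin n) (Fin n) ℤ) (α β : Fin n → ℤ) : ℤ :=
  ∑ i, ∑ j, α i * B i j * β j

/-- The bilinear form `ε̲` on `ℤⁿ` with `ε̲(e_i,e_j) = B_{ij}` for `i < j`,
`ε̲(e_i,e_i) = B_{ii}/2` and `ε̲(e_i,e_j) = 0` for `i > j`. -/
def epsU {n : ℕ} (B : Matrix (Fin n) (Fin n) ℤ) (α β : Fin n → ℤ) : ℤ :=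
  ∑ i, ∑ j, α i * β j * (if i < j then B i j else if i = j then B i i / 2 else 0)

/-- The standard 2-cocycle `ε(α,β) = (−1)^{ε̲(α,β)}` of `B`. -/
def stdCocycle {n : ℕ} (B : Matrix (Fin n) (Fin n) ℤ) (α β : Fin n → ℤ) : ℝ :=
  (-1 : ℝ) ^ epsU B α β

/-- A generalized Γ-matrix with respect to the form `(α|β) = αᵀBβ` and the standard
2-cocycle `ε` of `B`. -/
def IsGammaMatrix {n : ℕ} (B : Matrix (Fin n) (Fin n) ℤ) {S : Type*}
    [AddCommGroup S] [Module ℝ S] (Γ : (Fin n → ℤ) → Module.End ℝ S) : Prop :=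
  Γ 0 = 1 ∧ (∀ α, Γ (-α) = Γ α) ∧
  (∀ α, Γ α * Γ α = ((-1 : ℝ) ^ (pairB B α α / 2)) • (1 : Module.End ℝ S)) ∧
  (∀ α β, Γ α * Γ β = ((-1 : ℝ) ^ pairB B α β) • (Γ β * Γ α)) ∧
  (∀ α β, Γ α * Γ β = stdCocycle B α β • Γ (α + β))

/-- The bilinear form `b(x,y) = xᵀAy` on `ℝⁿ`. -/
def formA {n : ℕ} (A : Matrix (Fin n) (Fin n) ℤ) :
    LinearMap.BilinForm ℝ (Fin n → ℝ) :=
  Matrix.toBilin' (A.map ((↑) : ℤ → ℝ))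

/-- The reflection `s_α(v) = v − b(α,v)·α`. -/
def reflB {V : Type*} [AddCommGroup V] [Module ℝ V]
    (b : LinearMap.BilinForm ℝ V) (α : V) : Module.End ℝ V :=
  LinearMap.id - LinearMap.smulRight (b α) α

/-- The 3/2-spin operator `T_γ = (s_γ − ½·id) ⊗ Γ(γ)` attached to `γ ∈ ℤⁿ`. -/
def T32 {n : ℕ} (A : Matrix (Fin n) (Fin n) ℤ) {S : Type*}
    [AddCommGroup S] [Module ℝ S] (Γ : (Fin n → ℤ) → Module.End ℝ S)
    (γ : Fin n → ℤ) : Module.End ℝ ((Fin n → ℝ) ⊗[ℝ] S) :=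
  TensorProduct.map
    (reflB (formA A) (fun k => (γ k : ℝ)) - (1/2 : ℝ) • 1) (Γ γ)

/-- `R_i = (1/√2)·s_{e_i} ⊗ (id + Γ(e_i))`, the image of a generator of the
spin-extended Weyl group under the lifted 3/2-spin representation. -/
def RW {n : ℕ} (A : Matrix (Fin n) (Fin n) ℤ) {S : Type*}
    [AddCommGroup S] [Module ℝ S] (Γ : (Fin n → ℤ) → Module.End ℝ S)
    (i : Fin n) : Module.End ℝ ((Fin n → ℝ) ⊗[ℝ] S) :=
  (Real.sqrt 2)⁻¹ •
    TensorProduct.map (reflB (formA A) (Pi.single i 1)) (1 + Γ (Pi.single i 1))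

/-- The inverse `R_i⁻¹ = (1/√2)·s_{e_i} ⊗ (id − Γ(e_i))`. -/
def RWinv {n : ℕ} (A : Matrix (Fin n) (Fin n) ℤ) {S : Type*}
    [AddCommGroup S] [Module ℝ S] (Γ : (Fin n → ℤ) → Module.End ℝ S)
    (i : Fin n) : Module.End ℝ ((Fin n → ℝ) ⊗[ℝ] S) :=
  (Real.sqrt 2)⁻¹ •
    TensorProduct.map (reflB (formA A) (Pi.single i 1)) (1 - Γ (Pi.single i 1))

theorem reflB_apply {V : Type*} [AddCommGroup V] [Module ℝ V]
    (b : LinearMap.BilinForm ℝ V) (α v : V) : reflB b α v = v - b α v • α := rfl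

theorem reflB_mul_self {V : Type*} [AddCommGroup V] [Module ℝ V]
    (b : LinearMap.BilinForm ℝ V) (α : V) (hα : b α α = 2) :
    reflB b α * reflB b α = 1 := by
  ext v
  simp only [Module.End.mul_apply, Module.End.one_apply, reflB_apply, map_sub, map_smul, hα]
  module

theorem reflB_conj {V : Type*} [AddCommGroup V] [Module ℝ V]
    (b : LinearMap.BilinForm ℝ V) (hb : ∀ x y, b x y = b y x) (α β : V) (hα : b α α = 2) :
    reflB b α * reflB b β * reflB b α = reflB b (reflB b α β) := by
  ext v
  simp only [Module.End.mul_apply, reflB_apply, map_sub, map_smul, smul_eq_mul, hα,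
    LinearMap.sub_apply, LinearMap.smul_apply, hb β α]
  module

theorem reflB_conj_sub_smul_one {V : Type*} [AddCommGroup V] [Module ℝ V]
    (b : LinearMap.BilinForm ℝ V) (hb : ∀ x y, b x y = b y x) (α β : V) (hα : b α α = 2)
    (c : ℝ) :
    reflB b α * (reflB b β - c • 1) * reflB b α = reflB b (reflB b α β) - c • 1 := by
  rw [mul_sub, sub_mul, reflB_conj b hb α β hα, mul_smul_comm, smul_mul_assoc, mul_one,
    reflB_mul_self b α hα]

theorem formA_intCast {n : ℕ} (A : Matrix (Fin n) (Fin n) ℤ) (α β : Fin n → ℤ) :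
    formA A (fun k => (α k : ℝ)) (fun k => (β k : ℝ)) = pairB A α β := by
  simp [formA, pairB, Matrix.toBilin'_apply]

theorem formA_symm {n : ℕ} (A : Matrix (Fin n) (Fin n) ℤ) (hA : ∀ i j, A i j = A j i)
    (x y : Fin n → ℝ) : formA A x y = formA A y x := by
  simp only [formA, Matrix.toBilin'_apply, Matrix.map_apply]
  rw [Finset.sum_comm]
  refine Finset.sum_congr rfl fun i _ => Finset.sum_congr rfl fun j _ => ?_
  rw [hA j i]
  ring

theorem intCast_single {n : ℕ} (i : Fin n) :
    (fun k => ((Pi.single i 1 : Fin n → ℤ) k : ℝ)) = Pi.single i 1 := by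
  funext k
  by_cases h : k = i <;> simp [h]

theorem intCast_reflection {n : ℕ} (A : Matrix (Fin n) (Fin n) ℤ) (i : Fin n)
    (β : Fin n → ℤ) :
    (fun k => ((β - pairB A (Pi.single i 1) β • Pi.single i 1 : Fin n → ℤ) k : ℝ)) =
      reflB (formA A) (Pi.single i 1) (fun k => (β k : ℝ)) := by
  rw [reflB_apply, ← intCast_single i, formA_intCast]
  funext k
  simp

theorem pairB_smul_single_self {n : ℕ} (A : Matrix (Fin n) (Fin n) ℤ) (i : Fin n) (k : ℤ) :
    pairB A (k • Pi.single i 1) (k • Pi.single i 1) = k * A i i * k := by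
  simp [pairB, Pi.single_apply]

theorem epsU_smul_single_self {n : ℕ} (A : Matrix (Fin n) (Fin n) ℤ) (i : Fin n) (k : ℤ) :
    epsU A (k • Pi.single i 1) (k • Pi.single i 1) = k * k * (A i i / 2) := by
  rw [epsU, Finset.sum_eq_single i, Finset.sum_eq_single i]
  · simp
  · intro j _ hj
    simp [hj]
  · simp
  · intro j _ hj
    simp [hj]
  · simp

theorem epsU_smul_right {n : ℕ} (A : Matrix (Fin n) (Fin n) ℤ) (α β : Fin n → ℤ) (c : ℤ) :
    epsU A α (c • β) = c * epsU A α β := by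
  simp only [epsU, Finset.mul_sum, Pi.smul_apply, smul_eq_mul]
  refine Finset.sum_congr rfl fun i _ => Finset.sum_congr rfl fun j _ => ?_
  ring

theorem stdCocycle_even_smul_right {n : ℕ} (A : Matrix (Fin n) (Fin n) ℤ)
    (α β : Fin n → ℤ) {c : ℤ} (hc : Even c) : stdCocycle A α (c • β) = 1 := by
  rw [stdCocycle, epsU_smul_right]
  exact (hc.mul_right _).neg_one_zpow

namespace IsGammaMatrix

variable {n : ℕ} {A : Matrix (Fin n) (Fin n) ℤ} {S : Type*} [AddCommGroup S] [Module ℝ S]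
  {Γ : (Fin n → ℤ) → Module.End ℝ S}

theorem apply_even_smul_single (hΓ : IsGammaMatrix A Γ) {i : Fin n} (hi : A i i = 2)
    {m : ℤ} (hm : Even m) : Γ (m • Pi.single i 1) = 1 := by
  obtain ⟨k, rfl⟩ := hm
  obtain ⟨-, -, hsq, -, hmul⟩ := hΓ
  have h := hmul (k • Pi.single i 1) (k • Pi.single i 1)
  have hpair : k * 2 * k / 2 = k * k := by
    rw [show k * 2 * k = k * k * 2 by ring, Int.mul_ediv_cancel _ two_ne_zero]
  rw [hsq, stdCocycle, pairB_smul_single_self, epsU_smul_single_self, hi, hpair,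
    Int.ediv_self two_ne_zero, mul_one, ← add_smul] at h
  exact (smul_right_injective _ (zpow_ne_zero _ (neg_ne_zero.mpr one_ne_zero)) h).symm

theorem apply_add_even_smul_single (hΓ : IsGammaMatrix A Γ) {i : Fin n} (hi : A i i = 2)
    (α : Fin n → ℤ) {m : ℤ} (hm : Even m) : Γ (α + m • Pi.single i 1) = Γ α := by
  have h := hΓ.2.2.2.2 α (m • Pi.single i 1)
  rw [hΓ.apply_even_smul_single hi hm, stdCocycle_even_smul_right A _ _ hm, mul_one,
    one_smul] at h
  exact h.symm

theorem single_mul_self (hΓ : IsGammaMatrix A Γ) {i : Fin n} (hi : A i i = 2) :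
    Γ (Pi.single i 1) * Γ (Pi.single i 1) = -1 := by
  have h := pairB_smul_single_self A i 1
  rw [one_smul, hi] at h
  rw [hΓ.2.2.1, h]
  norm_num

theorem conj_of_even (hΓ : IsGammaMatrix A Γ) {i : Fin n} (hi : A i i = 2)
    (β : Fin n → ℤ) (hm : Even (pairB A (Pi.single i 1) β)) :
    (1 + Γ (Pi.single i 1)) * Γ β * (1 - Γ (Pi.single i 1)) =
      (2 : ℝ) • Γ (β - pairB A (Pi.single i 1) β • Pi.single i 1) := by
  have hcomm := hΓ.2.2.2.1 (Pi.single i 1) β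
  rw [hm.neg_one_zpow, one_smul] at hcomm
  rw [sub_eq_add_neg β, ← neg_smul, hΓ.apply_add_even_smul_single hi β hm.neg, add_mul, one_mul,
    hcomm, ← mul_one_add, mul_assoc, show (1 + Γ (Pi.single i 1)) * (1 - Γ (Pi.single i 1)) =
      1 - Γ (Pi.single i 1) * Γ (Pi.single i 1) by noncomm_ring, hΓ.single_mul_self hi,
    two_smul, sub_neg_eq_add, mul_add, mul_one]

theorem conj_of_odd (hΓ : IsGammaMatrix A Γ) {i : Fin n} (hi : A i i = 2)
    (β : Fin n → ℤ) (hm : Odd (pairB A (Pi.single i 1) β)) :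
    (1 + Γ (Pi.single i 1)) * Γ β * (1 - Γ (Pi.single i 1)) =
      (2 : ℝ) • stdCocycle A (Pi.single i 1) β •
        Γ (β - pairB A (Pi.single i 1) β • Pi.single i 1) := by
  have hcomm := hΓ.2.2.2.1 (Pi.single i 1) β
  rw [hm.neg_one_zpow, neg_one_smul] at hcomm
  have hβ : β - pairB A (Pi.single i 1) β • Pi.single i 1 =
      (Pi.single i 1 + β) + (-(pairB A (Pi.single i 1) β + 1)) • Pi.single i 1 := by
    module
  rw [hβ, hΓ.apply_add_even_smul_single hi _ hm.add_one.neg, ← hΓ.2.2.2.2, two_smul]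
  have hsq := hΓ.single_mul_self hi
  generalize Γ (Pi.single i 1) = g at *
  have hcomm' : Γ β * g = -(g * Γ β) := by rw [hcomm, neg_neg]
  calc (1 + g) * Γ β * (1 - g) = Γ β + g * Γ β - Γ β * g - g * (Γ β * g) := by noncomm_ring
    _ = Γ β + g * Γ β + g * Γ β + g * g * Γ β := by rw [hcomm']; noncomm_ring
    _ = g * Γ β + g * Γ β := by rw [hsq]; noncomm_ring

end IsGammaMatrix

theorem inv_sqrt_two_mul_self : (Real.sqrt 2)⁻¹ * (Real.sqrt 2)⁻¹ = (2 : ℝ)⁻¹ := by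
  rw [← mul_inv, Real.mul_self_sqrt zero_le_two]

theorem RW_mul_T32_mul_RWinv {n : ℕ} (A : Matrix (Fin n) (Fin n) ℤ)
    (hA : ∀ i j, A i j = A j i) {S : Type*} [AddCommGroup S] [Module ℝ S]
    (Γ : (Fin n → ℤ) → Module.End ℝ S) (i : Fin n) (hi : A i i = 2) (β : Fin n → ℤ) (c : ℝ)
    (hconj : (1 + Γ (Pi.single i 1)) * Γ β * (1 - Γ (Pi.single i 1)) =
      (2 : ℝ) • c • Γ (β - pairB A (Pi.single i 1) β • Pi.single i 1)) :
    RW A Γ i * T32 A Γ β * RWinv A Γ i =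
      c • T32 A Γ (β - pairB A (Pi.single i 1) β • Pi.single i 1) := by
  have he : formA A (Pi.single i 1) (Pi.single i 1) = 2 := by
    simp [formA, hi]
  rw [RW, RWinv, T32, T32, smul_mul_assoc, smul_mul_assoc, mul_smul_comm, smul_smul,
    inv_sqrt_two_mul_self, ← TensorProduct.map_mul, ← TensorProduct.map_mul, hconj,
    reflB_conj_sub_smul_one _ (formA_symm A hA) _ _ he, intCast_reflection,
    TensorProduct.map_smul_right, TensorProduct.map_smul_right, smul_smul,
    inv_mul_cancel₀ two_ne_zero, one_smul]

theorem RW_mul_RWinv {n : ℕ} {A : Matrix (Fin n) (Fin n) ℤ} {S : Type*} [AddCommGroup S]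
    [Module ℝ S] {Γ : (Fin n → ℤ) → Module.End ℝ S} (hΓ : IsGammaMatrix A Γ) {i : Fin n}
    (hi : A i i = 2) : RW A Γ i * RWinv A Γ i = 1 := by
  have he : formA A (Pi.single i 1) (Pi.single i 1) = 2 := by
    simp [formA, hi]
  have hg : (1 + Γ (Pi.single i 1)) * (1 - Γ (Pi.single i 1)) =
      (2 : ℝ) • (1 : Module.End ℝ S) := by
    rw [show (1 + Γ (Pi.single i 1)) * (1 - Γ (Pi.single i 1)) =
      1 - Γ (Pi.single i 1) * Γ (Pi.single i 1) by noncomm_ring, hΓ.single_mul_self hi,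
      two_smul, sub_neg_eq_add]
  rw [RW, RWinv, smul_mul_assoc, mul_smul_comm, smul_smul, inv_sqrt_two_mul_self,
    ← TensorProduct.map_mul, hg, reflB_mul_self _ _ he, TensorProduct.map_smul_right,
    TensorProduct.map_one, smul_smul, inv_mul_cancel₀ two_ne_zero, one_smul]

theorem RWinv_mul_RW {n : ℕ} (A : Matrix (Fin n) (Fin n) ℤ) {S : Type*} [AddCommGroup S]
    [Module ℝ S] (Γ : (Fin n → ℤ) → Module.End ℝ S) (i : Fin n) :
    RWinv A Γ i * RW A Γ i = RW A Γ i * RWinv A Γ i := by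
  rw [RW, RWinv, smul_mul_smul_comm, smul_mul_smul_comm, ← TensorProduct.map_mul,
    ← TensorProduct.map_mul]
  congr 2
  noncomm_ring

/-- Conjugation of the 3/2-spin operators by the spin-extended Weyl group: `R_i` is
invertible with the stated inverse, and conjugation sends `T_β` to `±T_{s_i·β}` with
sign given by the standard 2-cocycle. -/
theorem statement19 {n : ℕ} (A : Matrix (Fin n) (Fin n) ℤ)
    (hdiag : ∀ i, A i i = 2)
    (hoffdiag : ∀ i j, i ≠ j → A i j = 0 ∨ A i j = -1)
    (hzero : ∀ i j, A i j = 0 ↔ A j i = 0)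
    {S : Type*} [AddCommGroup S] [Module ℝ S] [FiniteDimensional ℝ S]
    (Γ : (Fin n → ℤ) → Module.End ℝ S) (hΓ : IsGammaMatrix A Γ) :
    ∀ i : Fin n,
      RW A Γ i * RWinv A Γ i = 1 ∧ RWinv A Γ i * RW A Γ i = 1 ∧
      ∀ β : Fin n → ℤ, pairB A β β = 2 →
        (Even (pairB A (Pi.single i 1) β) →
          RW A Γ i * T32 A Γ β * RWinv A Γ i
            = T32 A Γ (β - pairB A (Pi.single i 1) β • Pi.single i 1)) ∧
        (Odd (pairB A (Pi.single i 1) β) →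
          RW A Γ i * T32 A Γ β * RWinv A Γ i
            = stdCocycle A (Pi.single i 1) β •
                T32 A Γ (β - pairB A (Pi.single i 1) β • Pi.single i 1)) := by
  have hA : ∀ i j, A i j = A j i := by
    intro i j
    by_cases hij : i = j
    · rw [hij]
    · have h₁ := hoffdiag i j hij
      have h₂ := hoffdiag j i (Ne.symm hij)
      have h₃ := hzero i j
      omega
  intro i
  have hinv := RW_mul_RWinv hΓ (hdiag i)
  refine ⟨hinv, (RWinv_mul_RW A Γ i).trans hinv, fun β _ => ⟨fun hm => ?_, fun hm => ?_⟩⟩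
  · have h := RW_mul_T32_mul_RWinv A hA Γ i (hdiag i) β 1
      (by rw [one_smul, hΓ.conj_of_even (hdiag i) β hm])
    rwa [one_smul] at h
  · exact RW_mul_T32_mul_RWinv A hA Γ i (hdiag i) β _ (hΓ.conj_of_odd (hdiag i) β hm)
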